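/- arXiv:1708.07597 — 2 statements merged into one kernel-verified Lean document; each statement's English description precedes it below -/
import Mathlib

section
/- Let q = p^e be an odd prime power with q ≡ 2 (mod 3), and let 3 ≤ k ≤ e+2. Let g_i(X) = X^3 and f_i(X) = X^{p^{i−2}} for each 3 ≤ i ≤ k. Then S(k,q) is connected and λ_2(S(k,q)) ≤ max{ q(p^{k−3} − 1), (q−1)·M_q }; moreover M_q ≤ 2√q. -/
/-- The exponential sum `ε_f = Σ_{x ∈ F_q} ζ_p^{Tr(f(x))}` of a polynomial `f` over `F_q`,
where `ζ_p = exp(2πi/p)` and `Tr : F_q → F_p` is the absolute trace. -/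
noncomputable def expSum (p : ℕ) (F : Type) [Field F] [Fintype F] [Algebra (ZMod p) F]
    (f : Polynomial F) : ℂ :=
  ∑ x : F, Complex.exp (2 * Real.pi * Complex.I / p) ^ (Algebra.trace (ZMod p) F (f.eval x)).val

/-- The list of eigenvalues (with multiplicity) of a Hermitian real matrix,
sorted in increasing order. -/
noncomputable def eigSorted {V : Type} [Fintype V] [DecidableEq V] {A : Matrix V V ℝ}
    (hA : A.IsHermitian) : List ℝ :=
  (Finset.univ.val.map hA.eigenvalues).sort (· ≤ ·)

/-- The second largest eigenvalue (with multiplicity) of a Hermitian real matrix on at least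
two indices: the entry at position `card V - 2` of the increasingly sorted list of its
`card V` eigenvalues. -/
noncomputable def secondLargestEig {V : Type} [Fintype V] [DecidableEq V] {A : Matrix V V ℝ}
    (hA : A.IsHermitian) : ℝ :=
  (eigSorted hA).getD (Fintype.card V - 2) 0

open Polynomial Finset

theorem exists_frobenius_relation {K : Type*} [Field K] {p P d : ℕ} (hp : 2 ≤ p) (hP : 1 ≤ P)
    (h : K[X]) (hh : h.natDegree ≤ d * P) :
    ∃ c : Fin P × Fin p × Fin (P + (2 * d + 3)) → K, c ≠ 0 ∧
      ∑ i, C (c i) * (X ^ (p * P * i.1 + i.2.2) * h ^ (i.2.1 : ℕ)) = 0 := by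
  classical
  let N := p * P * P + P + (2 * d + 3) + d * (p * P)
  let L : (Fin P × Fin p × Fin (P + (2 * d + 3)) → K) →ₗ[K] K[X] :=
    Fintype.linearCombination K
      fun i => X ^ (p * P * i.1 + i.2.2 : ℕ) * h ^ (i.2.1 : ℕ)
  have hL : ∀ c, L c = ∑ i, C (c i) * (X ^ (p * P * i.1 + i.2.2) * h ^ (i.2.1 : ℕ)) := fun c => by
    simp [L, Fintype.linearCombination_apply, smul_eq_C_mul]
  have hmem : ∀ c, L c ∈ degreeLT K N := by
    intro c
    rw [hL]
    refine Submodule.sum_mem _ fun i _ => ?_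
    rw [mem_degreeLT]
    refine degree_le_natDegree.trans_lt (Nat.cast_lt.2 ?_)
    have h1 : (C (c i) * (X ^ (p * P * i.1 + i.2.2 : ℕ) * h ^ (i.2.1 : ℕ))).natDegree ≤
        (p * P * i.1 + i.2.2) + i.2.1 * h.natDegree :=
      (natDegree_C_mul_le _ _).trans
        (natDegree_mul_le.trans (add_le_add (natDegree_X_pow_le _) natDegree_pow_le))
    have h2 : p * P * i.1 ≤ p * P * P := Nat.mul_le_mul_left _ i.1.2.le
    have h3 : i.2.1 * h.natDegree ≤ p * (d * P) := Nat.mul_le_mul i.2.1.2.le hh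
    have h4 := i.2.2.2
    have h5 : p * (d * P) = d * (p * P) := by ring
    simp only [N]
    omega
  let L' := L.codRestrict _ hmem
  have hker : LinearMap.ker L' ≠ ⊥ := by
    apply LinearMap.ker_ne_bot_of_finrank_lt
    rw [(degreeLTEquiv K N).finrank_eq]
    simp only [Module.finrank_fintype_fun_eq_card, Fintype.card_prod,
      Fintype.card_fin]
    have h1 : (d + 3) * (p * P) > P + (2 * d + 3) := by
      nlinarith [Nat.mul_le_mul hp hP]
    simp only [N]
    nlinarith
  obtain ⟨c, hc, hc0⟩ := (Submodule.ne_bot_iff _).1 hker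
  refine ⟨c, hc0, ?_⟩
  rw [← hL]
  exact congrArg Subtype.val hc

theorem sum_monomial_mul_pow_ne_zero {K : Type*} [Field K] {p P d n : ℕ} (hp : p.Prime)
    (hd : d.Coprime p) (h : K[X]) (hP : 1 ≤ P) (hh : h.natDegree = d * P)
    (c : Fin P × Fin p × Fin n → K) (hc : c ≠ 0) :
    ∑ i, C (c i) * (X ^ (i.1 + p * P * i.2.2 : ℕ) * h ^ (i.2.1 : ℕ)) ≠ 0 := by
  classical
  have hd0 : 0 < d := Nat.pos_of_ne_zero fun h0 => hp.one_lt.ne' (by simpa [h0] using hd)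
  have hh0 : h ≠ 0 := by
    rintro rfl
    simp at hh; omega
  have hdeg : ∀ i : Fin P × Fin p × Fin n,
      (X ^ (i.1 + p * P * i.2.2 : ℕ) * h ^ (i.2.1 : ℕ)).natDegree
        = i.1 + P * (p * i.2.2 + d * i.2.1) := fun i => by
    rw [natDegree_mul (by simp) (pow_ne_zero _ hh0), natDegree_X_pow, natDegree_pow, hh]
    ring
  have hinj : ∀ i j : Fin P × Fin p × Fin n,
      (i.1 : ℕ) + P * (p * i.2.2 + d * i.2.1) = j.1 + P * (p * j.2.2 + d * j.2.1) → i = j := by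
    rintro ⟨i, j, k⟩ ⟨i', j', k'⟩ he
    simp only at he
    have e1 : (i : ℕ) = i' := by
      have := congrArg (· % P) he
      simpa [Nat.add_mul_mod_self_left, Nat.mod_eq_of_lt i.2, Nat.mod_eq_of_lt i'.2] using this
    have e2 : p * (k : ℕ) + d * j = p * k' + d * j' := by
      rw [e1] at he
      exact Nat.eq_of_mul_eq_mul_left hP (Nat.add_left_cancel he)
    have e3 : (j : ℕ) = j' := by
      have : d * (j : ℕ) ≡ d * j' [MOD p] := by
        have := congrArg (· % p) e2
        simpa [Nat.ModEq, Nat.mul_add_mod] using this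
      have := Nat.ModEq.cancel_left_of_coprime (by rwa [Nat.coprime_comm] at hd) this
      simpa [Nat.ModEq, Nat.mod_eq_of_lt j.2, Nat.mod_eq_of_lt j'.2] using this
    have e4 : (k : ℕ) = k' := by
      rw [e3] at e2
      exact Nat.eq_of_mul_eq_mul_left hp.pos (Nat.add_right_cancel e2)
    simp [Prod.ext_iff, Fin.ext_iff, e1, e3, e4]
  obtain ⟨i₀, hi₀⟩ := Function.ne_iff.1 hc
  have hne : ∀ i, c i ≠ 0 → C (c i) * (X ^ (i.1 + p * P * i.2.2 : ℕ) * h ^ (i.2.1 : ℕ)) ≠ 0 :=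
    fun i hi => mul_ne_zero (C_ne_zero.2 hi) (mul_ne_zero (by simp) (pow_ne_zero _ hh0))
  have key := degree_sum_eq_of_disjoint
    (fun i => C (c i) * (X ^ (i.1 + p * P * i.2.2 : ℕ) * h ^ (i.2.1 : ℕ))) univ (by
      rintro i ⟨-, hi⟩ j ⟨-, hj⟩ hij hdd
      refine hij (hinj i j ?_)
      have hi' : c i ≠ 0 := fun h0 => hi (by simp [h0])
      have hj' : c j ≠ 0 := fun h0 => hj (by simp [h0])
      have := natDegree_eq_of_degree_eq hdd
      simpa only [natDegree_C_mul hi', natDegree_C_mul hj', hdeg] using this)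
  intro h0
  rw [h0, degree_zero] at key
  have := (Finset.sup_eq_bot_iff _ _).1 key.symm i₀ (mem_univ _)
  exact hne i₀ hi₀ (degree_eq_bot.1 this)

/-- Stepanov's method: an upper bound for the number of points where the trace of a polynomial
takes a given value, over a field of square order. -/
theorem card_trace_eq_le {p m d : ℕ} [hp : Fact p.Prime] {K : Type*} [Field K] [Fintype K]
    [Algebra (ZMod p) K] (hK : Fintype.card K = p ^ (2 * (m + 1))) (f : K[X])
    (hf : f.natDegree = d) (hd : d.Coprime p) (t : ZMod p) :
    #{x : K | Algebra.trace (ZMod p) K (f.eval x) = t} ≤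
      p ^ (2 * m + 1) + (3 * d + 4) * p ^ (m + 1) := by
  classical
  have hchar : CharP K p := charP_of_injective_algebraMap (algebraMap (ZMod p) K).injective p
  set P := p ^ m with hP
  have hP1 : 1 ≤ P := Nat.one_le_pow _ _ hp.out.pos
  have hQ : p * P = p ^ (m + 1) := by rw [hP]; ring
  have hd0 : 0 < d := Nat.pos_of_ne_zero fun h0 => hp.out.one_lt.ne' (by simpa [h0] using hd)
  set h : K[X] := ∑ i ∈ range (m + 1), f ^ p ^ i with hh
  have hdeg : h.natDegree = d * P := by
    have hlt : ∀ n, (∑ i ∈ range n, f ^ p ^ i).natDegree < d * p ^ n := by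
      intro n
      induction n with
      | zero => simpa using hd0
      | succ n ih =>
        have h1 : d * p ^ n < d * p ^ (n + 1) :=
          Nat.mul_lt_mul_of_pos_left (Nat.pow_lt_pow_right hp.out.one_lt n.lt_succ_self) hd0
        rw [sum_range_succ]
        refine (natDegree_add_le _ _).trans_lt (max_lt (ih.trans h1) ?_)
        rwa [natDegree_pow, hf, mul_comm]
    rw [hh, sum_range_succ, natDegree_add_eq_right_of_natDegree_lt, natDegree_pow, hf, mul_comm]
    rw [natDegree_pow, hf, mul_comm]
    exact hlt m
  have hfin : Module.finrank (ZMod p) K = 2 * (m + 1) := by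
    have := Module.card_eq_pow_finrank (K := ZMod p) (V := K)
    rw [hK, ZMod.card] at this
    exact (Nat.pow_right_injective hp.out.two_le this).symm
  have htr : ∀ x : K, algebraMap (ZMod p) K (Algebra.trace (ZMod p) K (f.eval x)) =
      h.eval x + (h.eval x) ^ (p * P) := by
    intro x
    rw [FiniteField.algebraMap_trace_eq_sum_pow, hfin, Nat.card_zmod, two_mul, sum_range_add,
      hh, eval_finsetSum, hQ, sum_pow_char_pow]
    simp only [eval_pow, ← pow_mul, ← pow_add, add_comm]
  obtain ⟨c, hc0, hc⟩ := exists_frobenius_relation (p := p) (d := d) hp.out.two_le hP1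
    (C (algebraMap (ZMod p) K t) - h)
    ((natDegree_sub_le _ _).trans (by simp [hdeg]))
  choose r hr using fun x : K => (iterateFrobeniusEquiv K p (m + 1)).surjective x
  simp only [iterateFrobeniusEquiv_apply, iterateFrobenius_def, ← hQ] at hr
  set E : K[X] := ∑ i, C (r (c i)) * (X ^ (i.1 + p * P * i.2.2 : ℕ) * h ^ (i.2.1 : ℕ)) with hE
  have hE0 : E ≠ 0 := by
    apply sum_monomial_mul_pow_ne_zero hp.out hd h hP1 hdeg
    intro h0
    apply hc0
    ext i
    rw [← hr (c i), congrFun h0 i]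
    simp [hp.out.ne_zero, Nat.one_le_iff_ne_zero.1 hP1]
  have hroot : ∀ x : K, Algebra.trace (ZMod p) K (f.eval x) = t → E.eval x = 0 := by
    intro x hx
    have h1 : (h.eval x) ^ (p * P) = algebraMap (ZMod p) K t - h.eval x := by
      rw [← hx, htr]; ring
    have h2 : x ^ (p * P * (p * P)) = x := by
      have := FiniteField.pow_card x
      rw [hK] at this
      rw [hQ, ← pow_add]
      convert this using 2
      ring
    have h3 := congrArg (eval x) hc
    simp only [eval_finsetSum, eval_mul, eval_pow, eval_X, eval_C, eval_sub, eval_zero] at h3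
    refine eq_zero_of_pow_eq_zero (n := p ^ (m + 1)) ?_
    rw [hE, eval_finsetSum, sum_pow_char_pow, ← h3]
    refine sum_congr rfl fun i _ => ?_
    simp only [eval_mul, eval_pow, eval_X, eval_C, mul_pow, ← hQ, hr]
    congr 2
    · rw [← pow_mul, mul_comm, mul_add, pow_add, pow_add]
      congr 1
      rw [← mul_assoc, pow_mul, h2]
    · rw [← pow_mul, mul_comm, pow_mul, h1]
  have hEdeg : E.natDegree ≤ P + p * P * (P + (2 * d + 3)) + p * (d * P) := by
    refine natDegree_sum_le_of_forall_le _ _ fun i _ => ?_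
    refine (natDegree_C_mul_le _ _).trans
        (natDegree_mul_le.trans (add_le_add ((natDegree_X_pow_le _).trans ?_)
          (natDegree_pow_le.trans ?_)))
    · exact add_le_add i.1.2.le (Nat.mul_le_mul_left _ i.2.2.2.le)
    · rw [hdeg]
      exact Nat.mul_le_mul_right _ i.2.1.2.le
  have hcard := Polynomial.card_le_degree_of_subset_roots (p := E)
    (Z := {x : K | Algebra.trace (ZMod p) K (f.eval x) = t}) (by
      intro x hx
      rw [mem_roots hE0]
      exact hroot x (by simpa using hx))
  have h6 : P ≤ p * P := Nat.le_mul_of_pos_left _ hp.out.pos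
  calc _ ≤ _ := hcard.trans hEdeg
    _ ≤ p * P * P + (3 * d + 4) * (p * P) := by nlinarith
    _ = _ := by rw [hP]; ring

/-- The canonical additive character `x ↦ exp (2πi Tr x / p)` of a finite field. -/
noncomputable def traceChar (p : ℕ) [NeZero p] (K : Type*) [Field K] [Algebra (ZMod p) K] :
    AddChar K ℂ :=
  ZMod.stdAddChar.compAddMonoidHom (Algebra.trace (ZMod p) K).toAddMonoidHom

theorem traceChar_apply (p : ℕ) [NeZero p] {K : Type*} [Field K] [Algebra (ZMod p) K] (x : K) :
    traceChar p K x = ZMod.stdAddChar (Algebra.trace (ZMod p) K x) := rfl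

theorem traceChar_ne_one (p : ℕ) [hp : Fact p.Prime] (K : Type*) [Field K] [Finite K]
    [Algebra (ZMod p) K] : traceChar p K ≠ 1 := by
  intro h
  obtain ⟨x, hx⟩ := Algebra.trace_surjective (ZMod p) K 1
  have h1 : ZMod.stdAddChar (1 : ZMod p) = 1 := by
    rw [← hx, ← traceChar_apply, h, AddChar.one_apply]
  rw [← AddChar.map_zero_eq_one (ZMod.stdAddChar (N := p))] at h1
  exact one_ne_zero (ZMod.injective_stdAddChar h1)

theorem norm_sum_traceChar_le {p m d : ℕ} [hp : Fact p.Prime] {K : Type*} [Field K] [Fintype K]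
    [Algebra (ZMod p) K] (hK : Fintype.card K = p ^ (2 * (m + 1))) (f : K[X])
    (hf : f.natDegree = d) (hd : d.Coprime p) :
    ‖∑ x : K, traceChar p K (f.eval x)‖ ≤ 2 * p * (3 * d + 4) * p ^ (m + 1) := by
  classical
  set A : ZMod p → ℝ := fun t => #{x : K | Algebra.trace (ZMod p) K (f.eval x) = t} with hA
  set D : ZMod p → ℝ := fun t => A t - p ^ (2 * m + 1) with hD
  have hAsum : ∑ t, A t = p ^ (2 * (m + 1)) := by
    have := card_eq_sum_card_fiberwise (f := fun x : K => Algebra.trace (ZMod p) K (f.eval x))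
      (s := univ) (t := univ) (fun _ _ => by simp)
    rw [card_univ, hK] at this
    simp only [hA]
    exact_mod_cast this.symm
  have hDsum : ∑ t, D t = 0 := by
    simp only [hD, sum_sub_distrib, hAsum, sum_const, card_univ, ZMod.card, nsmul_eq_mul]
    ring
  have hDle : ∀ t, D t ≤ (3 * d + 4) * p ^ (m + 1) := fun t => by
    have := card_trace_eq_le hK f hf hd t
    simp only [hD, hA, sub_le_iff_le_add']
    exact_mod_cast this
  have hS : ∑ x : K, traceChar p K (f.eval x) = ∑ t, (D t : ℂ) * ZMod.stdAddChar t := by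
    have h0 : ∑ t : ZMod p, ZMod.stdAddChar t = (0 : ℂ) :=
      AddChar.sum_eq_zero_of_ne_one (by
        have := ZMod.isPrimitive_stdAddChar p (one_ne_zero (α := ZMod p))
        rwa [AddChar.mulShift_one] at this)
    rw [← sum_fiberwise_of_maps_to (s := univ) (t := univ)
      (g := fun x : K => Algebra.trace (ZMod p) K (f.eval x)) (fun _ _ => mem_univ _)]
    simp only [hD, Complex.ofReal_sub, sub_mul, sum_sub_distrib, ← mul_sum, h0, mul_zero, sub_zero]
    refine sum_congr rfl fun t _ => ?_
    rw [sum_congr rfl (g := fun _ => ZMod.stdAddChar t) fun x hx => by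
      rw [traceChar_apply, (mem_filter.1 hx).2]]
    simp [hA]
  rw [hS]
  calc ‖∑ t, (D t : ℂ) * ZMod.stdAddChar t‖ ≤ ∑ t, |D t| := by
        refine (norm_sum_le _ _).trans (sum_le_sum fun t _ => ?_)
        rw [norm_mul, AddChar.norm_apply, mul_one, Complex.norm_real, Real.norm_eq_abs]
    _ ≤ ∑ t : ZMod p, (2 * ((3 * d + 4) * p ^ (m + 1)) - D t) := by
        refine sum_le_sum fun t _ => abs_le.2 ⟨?_, ?_⟩
        · have : (0 : ℝ) ≤ (3 * d + 4) * p ^ (m + 1) := by positivity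
          linarith
        · linarith [hDle t]
    _ = _ := by
        rw [sum_sub_distrib, hDsum, sum_const, card_univ, ZMod.card, nsmul_eq_mul]
        ring

theorem AddChar.IsPrimitive.exists_eq_mulShift {K : Type*} [Field K] [Finite K] {ψ : AddChar K ℂ}
    (hψ : ψ.IsPrimitive) (φ : AddChar K ℂ) : ∃ c, φ = ψ.mulShift c := by
  have := Fintype.ofFinite K
  have hinj := AddChar.to_mulShift_inj_of_isPrimitive hψ
  have := ((Fintype.bijective_iff_injective_and_card _).2 ⟨hinj, AddChar.card_eq.symm⟩).2 φ
  exact this.imp fun _ h => h.symm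

theorem norm_sum_addChar_le {p m d : ℕ} [hp : Fact p.Prime] {K : Type*} [Field K] [Fintype K]
    [CharP K p] (hK : Fintype.card K = p ^ (2 * (m + 1))) {ψ : AddChar K ℂ} (hψ : ψ ≠ 1)
    (f : K[X]) (hf : f.natDegree = d) (hd : d.Coprime p) :
    ‖∑ x : K, ψ (f.eval x)‖ ≤ 2 * p * (3 * d + 4) * p ^ (m + 1) := by
  let := ZMod.algebra K p
  obtain ⟨c, rfl⟩ :=
    (AddChar.IsPrimitive.of_ne_one (traceChar_ne_one p K)).exists_eq_mulShift ψ
  have hc : c ≠ 0 := by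
    rintro rfl
    simp at hψ
  have := norm_sum_traceChar_le hK (C c * f) (by rwa [natDegree_C_mul hc]) hd
  simpa [AddChar.mulShift_apply] using this

theorem sum_sq_add_sum_nonsquare_mul_sq {F : Type*} [Field F] [Fintype F]
    (hF : ringChar F ≠ 2) {δ : F} (hδ : ¬ IsSquare δ) (g : F → ℂ) :
    ∑ v, g (v ^ 2) + ∑ v, g (δ * v ^ 2) = 2 * ∑ w, g w := by
  classical
  have hδ0 : δ ≠ 0 := by
    rintro rfl
    simp at hδ
  have hcount : ∀ w : F, ((#{v : F | v ^ 2 = w} : ℕ) : ℤ) = quadraticChar F w + 1 := fun w => by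
    rw [← quadraticChar_card_sqrts hF w]
    congr 2
    ext
    simp
  have hfib : ∀ h : F → F, ∑ v, g (h v) = ∑ w, (#{v | h v = w} : ℂ) * g w := fun h => by
    rw [← sum_fiberwise_of_maps_to (s := univ) (t := univ) (g := h) (fun _ _ => mem_univ _)]
    refine sum_congr rfl fun w _ => ?_
    rw [sum_congr rfl (g := fun _ => g w) fun x hx => by rw [(mem_filter.1 hx).2]]
    simp
  rw [hfib, hfib, ← sum_add_distrib, mul_sum]
  refine sum_congr rfl fun w _ => ?_
  rw [← add_mul]
  congr 1
  have h1 : #{v : F | δ * v ^ 2 = w} = #{v : F | v ^ 2 = δ⁻¹ * w} := by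
    congr 1
    ext v
    simp [eq_inv_mul_iff_mul_eq₀ hδ0]
  have h2 : (#{v : F | v ^ 2 = w} : ℤ) + #{v : F | δ * v ^ 2 = w} = 2 := by
    rw [h1, hcount, hcount, map_mul]
    have : quadraticChar F δ⁻¹ = -1 := by
      rw [quadraticChar_neg_one_iff_not_isSquare, isSquare_inv]
      exact hδ
    rw [this]
    ring
  exact_mod_cast h2

/-- The exponential sum of the cubic `a x³ + b x` with respect to an additive character. -/
noncomputable def cubicSum {F : Type*} [Field F] [Fintype F] (ψ : AddChar F ℂ) (a b : F) : ℂ :=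
  ∑ x, ψ (a * x ^ 3 + b * x)

noncomputable instance {F : Type*} [Fintype F] (a b : F) : Fintype (QuadraticAlgebra F a b) :=
  Fintype.ofEquiv _ (QuadraticAlgebra.equivProd a b).symm

/-- The additive character `z ↦ ψ (Tr z)` of a quadratic algebra `F[√δ]`. -/
noncomputable def quadChar {F : Type*} [Field F] (ψ : AddChar F ℂ) (δ : F) :
    AddChar (QuadraticAlgebra F δ 0) ℂ where
  toFun z := ψ (2 * z.re)
  map_zero_eq_one' := by simp
  map_add_eq_mul' z w := by rw [QuadraticAlgebra.re_add, mul_add, AddChar.map_add_eq_mul]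

theorem quadChar_ne_one {F : Type*} [Field F] (hF : ringChar F ≠ 2) {ψ : AddChar F ℂ} (hψ : ψ ≠ 1)
    (δ : F) : quadChar ψ δ ≠ 1 := by
  obtain ⟨x, hx⟩ := AddChar.ne_one_iff.1 hψ
  refine AddChar.ne_one_iff.2 ⟨⟨x / 2, 0⟩, ?_⟩
  change ψ (2 * (x / 2)) ≠ 1
  rwa [mul_div_cancel₀ _ (Ring.two_ne_zero hF)]

/-- The Hasse–Davenport relation for cubic exponential sums and the quadratic extension `F[√δ]`. -/
theorem cubicSum_sq_add_cubicSum_quadChar {F : Type*} [Field F] [Fintype F]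
    (hF : ringChar F ≠ 2) (h3 : (3 : F) ≠ 0) {ψ : AddChar F ℂ} (hψ : ψ ≠ 1) {δ : F}
    [Fact (∀ r : F, r ^ 2 ≠ δ + 0 * r)] (hδ : ¬ IsSquare δ) {a : F} (ha : a ≠ 0) (b : F) :
    cubicSum ψ a b ^ 2 +
      cubicSum (quadChar ψ δ) (algebraMap F _ a) (algebraMap F _ b) = 2 * Fintype.card F := by
  classical
  have h2 : (2 : F) ≠ 0 := Ring.two_ne_zero hF
  let e : F × F ≃ F × F :=
    { toFun := fun z => (z.1 + z.2, z.1 - z.2)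
      invFun := fun z => ((z.1 + z.2) / 2, (z.1 - z.2) / 2)
      left_inv := fun z => by ext <;> simp <;> field_simp <;> ring
      right_inv := fun z => by ext <;> simp <;> field_simp <;> ring }
  have hsq : cubicSum ψ a b ^ 2 =
      ∑ u : F, ψ (2 * a * u ^ 3 + 2 * b * u) * ∑ v : F, ψ (v ^ 2 * (6 * a * u)) := by
    rw [sq, cubicSum, sum_mul_sum, ← Fintype.sum_prod_type', ← e.sum_comp, Fintype.sum_prod_type]
    refine sum_congr rfl fun u _ => ?_
    rw [mul_sum]
    refine sum_congr rfl fun v _ => ?_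
    rw [← AddChar.map_add_eq_mul, ← AddChar.map_add_eq_mul]
    congr 1
    simp only [e, Equiv.coe_fn_mk]
    ring
  have hK : cubicSum (quadChar ψ δ) (algebraMap F _ a) (algebraMap F _ b) =
      ∑ u : F, ψ (2 * a * u ^ 3 + 2 * b * u) * ∑ v : F, ψ (δ * v ^ 2 * (6 * a * u)) := by
    rw [cubicSum, ← (QuadraticAlgebra.equivProd δ 0).symm.sum_comp, Fintype.sum_prod_type]
    refine sum_congr rfl fun u _ => ?_
    rw [mul_sum]
    refine sum_congr rfl fun v _ => ?_
    rw [← AddChar.map_add_eq_mul]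
    change ψ _ = ψ _
    congr 1
    simp [pow_succ, QuadraticAlgebra.algebraMap_re]
    ring
  rw [hsq, hK, ← sum_add_distrib]
  have hin : ∀ u : F, ∑ v : F, ψ (v ^ 2 * (6 * a * u)) + ∑ v : F, ψ (δ * v ^ 2 * (6 * a * u)) =
      if u = 0 then 2 * (Fintype.card F : ℂ) else 0 := fun u => by
    rw [sum_sq_add_sum_nonsquare_mul_sq hF hδ (fun w => ψ (w * (6 * a * u))),
      AddChar.sum_mulShift _ (AddChar.IsPrimitive.of_ne_one hψ)]
    have h6 : (6 : F) ≠ 0 := by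
      rw [show (6 : F) = 2 * 3 by norm_num]
      exact mul_ne_zero h2 h3
    by_cases hu : u = 0 <;> simp [hu, h6, ha]
  simp_rw [← mul_add, hin]
  simp

universe u

theorem norm_cubicSum_sq_le {p : ℕ} [hp : Fact p.Prime] (hp2 : p ≠ 2) (hp3 : p ≠ 3) {B : ℝ}
    {F : Type u} [Field F] [Fintype F] [CharP F p] {ψ : AddChar F ℂ} (hψ : ψ ≠ 1) {a : F}
    (ha : a ≠ 0) (b : F)
    (hB : ∀ (K : Type u) [Field K] [Fintype K] [CharP K p] (φ : AddChar K ℂ) (a₁ b₁ : K), φ ≠ 1 →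
      a₁ ≠ 0 → Fintype.card K = Fintype.card F ^ 2 → ‖cubicSum φ a₁ b₁‖ ≤ B) :
    ‖cubicSum ψ a b‖ ^ 2 ≤ 2 * Fintype.card F + B := by
  have hchar : ringChar F = p := ringChar.eq F p
  have h3 : (3 : F) ≠ 0 := by
    have := (CharP.cast_eq_zero_iff F p 3).not.2
      (fun h => hp3 ((Nat.prime_dvd_prime_iff_eq hp.out Nat.prime_three).1 h))
    exact_mod_cast this
  obtain ⟨δ, hδ⟩ := FiniteField.exists_nonsquare (F := F) (by rwa [hchar])
  have : Fact (∀ r : F, r ^ 2 ≠ δ + 0 * r) :=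
    ⟨fun r hr => hδ ⟨r, by rw [← sq, hr]; ring⟩⟩
  have : CharP (QuadraticAlgebra F δ 0) p :=
    charP_of_injective_algebraMap (algebraMap F (QuadraticAlgebra F δ 0)).injective p
  have hrel := cubicSum_sq_add_cubicSum_quadChar (by rwa [hchar]) h3 hψ hδ ha b
  have hcard : Fintype.card (QuadraticAlgebra F δ 0) = Fintype.card F ^ 2 := by
    rw [Fintype.card_congr (QuadraticAlgebra.equivProd δ 0), Fintype.card_prod, sq]
  have hK := hB _ _ (algebraMap F _ a) (algebraMap F _ b)
    (quadChar_ne_one (by rwa [hchar]) hψ δ) (by simpa using ha) hcard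
  rw [← norm_pow, eq_sub_of_add_eq hrel]
  refine (norm_sub_le _ _).trans (add_le_add ?_ hK)
  simp

theorem norm_cubicSum_le_add_pow {p : ℕ} [hp : Fact p.Prime] (hp2 : p ≠ 2) (hp3 : p ≠ 3) (j : ℕ) :
    ∀ (F : Type u) [Field F] [Fintype F] [CharP F p] (ψ : AddChar F ℂ) (a b : F), ψ ≠ 1 →
      a ≠ 0 → ‖cubicSum ψ a b‖ ≤ (2 + 26 * p * (1 / 4) ^ j) * √(Fintype.card F) := by
  have hsqrt : ∀ n : ℕ, √(n : ℝ) ^ 2 = n := fun n => Real.sq_sqrt n.cast_nonneg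
  induction j with
  | zero =>
    intro F _ _ _ ψ a b hψ ha
    obtain ⟨n, -, hn⟩ := FiniteField.card F p
    have key := norm_cubicSum_sq_le (B := 26 * p * Fintype.card F) hp2 hp3 hψ ha b (by
      intro K _ _ _ φ a₁ b₁ hφ ha' hK
      obtain ⟨m, hm⟩ := Nat.exists_eq_succ_of_ne_zero n.ne_zero
      have h1 := norm_sum_addChar_le (p := p) (m := m) (d := 3)
        (by rw [hK, hn, hm, ← pow_mul, mul_comm]) hφ (C a₁ * X ^ 3 + C b₁ * X)
        (by compute_degree!) ((Nat.coprime_primes Nat.prime_three hp.out).2 hp3.symm)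
      rw [hn, hm, cubicSum]
      simp only [eval_add, eval_mul, eval_C, eval_pow, eval_X] at h1
      refine h1.trans (le_of_eq ?_)
      push_cast [Nat.succ_eq_add_one]
      ring)
    refine abs_le_of_sq_le_sq' ?_ (by positivity) |>.2
    rw [mul_pow, hsqrt]
    refine key.trans ?_
    have : (0 : ℝ) ≤ p * Fintype.card F := by positivity
    have : (0 : ℝ) ≤ p * p * Fintype.card F := by positivity
    have : (0 : ℝ) ≤ Fintype.card F := by positivity
    nlinarith
  | succ j ih =>
    intro F _ _ _ ψ a b hψ ha
    have key := norm_cubicSum_sq_le (B := (2 + 26 * p * (1 / 4) ^ j) * Fintype.card F)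
      hp2 hp3 hψ ha b (by
        intro K _ _ _ φ a₁ b₁ hφ ha' hK
        have := ih K φ a₁ b₁ hφ ha'
        rwa [hK, Nat.cast_pow, Real.sqrt_sq (Nat.cast_nonneg _)] at this)
    refine abs_le_of_sq_le_sq' ?_ (by positivity) |>.2
    rw [mul_pow, hsqrt]
    refine key.trans ?_
    rw [← add_mul]
    refine mul_le_mul_of_nonneg_right ?_ (Nat.cast_nonneg _)
    rw [pow_succ (1 / 4 : ℝ) j]
    nlinarith [sq_nonneg (26 * p * ((1 / 4) ^ j * (1 / 4)) : ℝ)]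

/-- The Weil bound for cubic exponential sums over finite fields of characteristic
different from `2` and `3`. -/
theorem norm_cubicSum_le {p : ℕ} [hp : Fact p.Prime] (hp2 : p ≠ 2) (hp3 : p ≠ 3)
    {F : Type*} [Field F] [Fintype F] [CharP F p] {ψ : AddChar F ℂ} (hψ : ψ ≠ 1) {a : F}
    (ha : a ≠ 0) (b : F) : ‖cubicSum ψ a b‖ ≤ 2 * √(Fintype.card F) := by
  refine ge_of_tendsto' (f := fun j : ℕ => (2 + 26 * p * (1 / 4) ^ j) * √(Fintype.card F))
    (x := Filter.atTop) ?_ fun j => norm_cubicSum_le_add_pow hp2 hp3 j F ψ a b hψ ha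
  have := tendsto_pow_atTop_nhds_zero_of_lt_one (r := (1 / 4 : ℝ)) (by norm_num) (by norm_num)
  simpa using ((this.const_mul (26 * p : ℝ)).const_add 2).mul_const √(Fintype.card F : ℝ)

theorem sum_addChar_dotProduct {F ι : Type*} [Field F] [Fintype F] [Fintype ι] [DecidableEq ι]
    [DecidableEq F] {ψ : AddChar F ℂ} (hψ : ψ ≠ 1) (y : ι → F) :
    ∑ w : ι → F, ψ (w ⬝ᵥ y) = if y = 0 then (Fintype.card (ι → F) : ℂ) else 0 := by
  classical
  split_ifs with hy
  · simp [hy]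
  · obtain ⟨i, hi⟩ := Function.ne_iff.1 hy
    obtain ⟨x, hx⟩ := AddChar.ne_one_iff.1 hψ
    let χ : AddChar (ι → F) ℂ :=
      ψ.compAddMonoidHom ⟨⟨fun w => w ⬝ᵥ y, by simp⟩, fun v w => add_dotProduct v w y⟩
    refine AddChar.sum_eq_zero_of_ne_one (ψ := χ)
      (AddChar.ne_one_iff.2 ⟨Pi.single i (x / y i), ?_⟩)
    change ψ (Pi.single i (x / y i) ⬝ᵥ y) ≠ 1
    rwa [single_dotProduct, div_mul_cancel₀ _ hi]

/-- An eigenfunction of a Cayley graph on `F ^ ι` whose eigenvalue differs from those of all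
nontrivial characters is constant. -/
theorem eigenfunction_const {F ι T : Type*} [Field F] [Fintype F] [Fintype ι] [DecidableEq ι]
    {ψ : AddChar F ℂ} (hψ : ψ ≠ 1) (A : Finset T) (s : T → ι → F) {μ : ℂ} (v : (ι → F) → ℂ)
    (hv : ∀ x, ∑ τ ∈ A, v (x + s τ) = μ * v x)
    (hμ : ∀ w : ι → F, w ≠ 0 → ∑ τ ∈ A, ψ (w ⬝ᵥ s τ) ≠ μ) (x y : ι → F) : v x = v y := by
  classical
  set V : (ι → F) → ℂ := fun w => ∑ z, v z * ψ (w ⬝ᵥ z) with hV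
  have hVmul : ∀ w, μ * V w = (∑ τ ∈ A, ψ (-w ⬝ᵥ s τ)) * V w := by
    intro w
    calc μ * V w = ∑ z, ∑ τ ∈ A, v (z + s τ) * ψ (w ⬝ᵥ z) := by
          rw [hV, mul_sum]
          refine sum_congr rfl fun z _ => ?_
          rw [← mul_assoc, ← hv, sum_mul]
      _ = ∑ τ ∈ A, ∑ z, v z * ψ (w ⬝ᵥ (z - s τ)) := by
          rw [sum_comm]
          refine sum_congr rfl fun τ _ => ?_
          rw [← Equiv.sum_comp (Equiv.addRight (s τ)) (fun z => v z * ψ (w ⬝ᵥ (z - s τ)))]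
          simp
      _ = _ := by
          rw [sum_mul]
          refine sum_congr rfl fun τ _ => ?_
          rw [hV, mul_sum]
          refine sum_congr rfl fun z _ => ?_
          rw [dotProduct_sub, neg_dotProduct, sub_eq_neg_add, AddChar.map_add_eq_mul]
          ring
  have hV0 : ∀ w, w ≠ 0 → V w = 0 := fun w hw => by
    by_contra h0
    exact hμ (-w) (neg_ne_zero.2 hw) (mul_right_cancel₀ h0 (hVmul w)).symm
  have hinv : ∀ z, (Fintype.card (ι → F) : ℂ) * v z = V 0 := by
    intro z
    have h1 : ∑ w, V w * ψ (w ⬝ᵥ -z) = V 0 := by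
      rw [sum_eq_single 0 (fun w _ hw => by rw [hV0 w hw, zero_mul]) (by simp)]
      simp
    rw [← h1]
    simp only [hV, sum_mul]
    rw [sum_comm]
    simp_rw [mul_assoc, ← AddChar.map_add_eq_mul, ← dotProduct_add, ← mul_sum,
      sum_addChar_dotProduct hψ, add_neg_eq_zero]
    simp [mul_comm]
  exact mul_left_cancel₀ (Nat.cast_ne_zero.2 Fintype.card_ne_zero) ((hinv x).trans (hinv y).symm)

section CubicSum

variable {F : Type*} [Field F] [Fintype F]

theorem ofReal_re_cubicSum (ψ : AddChar F ℂ) (a b : F) :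
    ((cubicSum ψ a b).re : ℂ) = cubicSum ψ a b := by
  rw [← Complex.conj_eq_iff_re, cubicSum, map_sum, ← Equiv.sum_comp (Equiv.neg F)]
  refine sum_congr rfl fun x _ => ?_
  rw [← AddChar.map_neg_eq_conj]
  congr 1
  simp only [Equiv.neg_apply]
  ring

theorem cubicSum_zero_left [DecidableEq F] {ψ : AddChar F ℂ} (hψ : ψ ≠ 1) (b : F) :
    cubicSum ψ 0 b = if b = 0 then (Fintype.card F : ℂ) else 0 := by
  have := AddChar.sum_mulShift b (AddChar.IsPrimitive.of_ne_one hψ)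
  simp only [cubicSum, zero_mul, zero_add, mul_comm b, this]
  split_ifs <;> simp

theorem bijective_cube (hq : Fintype.card F % 3 = 2) :
    Function.Bijective fun x : F => x ^ 3 := by
  refine Finite.injective_iff_bijective.1 fun x y hxy => ?_
  obtain ⟨m, hm⟩ : ∃ m, Fintype.card F = 3 * m + 2 := ⟨Fintype.card F / 3, by omega⟩
  have key : ∀ z : F, (z ^ 3) ^ (2 * m + 1) = z := fun z => by
    have h := FiniteField.pow_card z
    calc (z ^ 3) ^ (2 * m + 1) = z ^ (3 * m + 1) * z ^ (3 * m + 2) := by ring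
      _ = z ^ (3 * m + 2) := by rw [← hm, h, ← pow_succ, ← hm, h]
      _ = z := by rw [← hm, h]
  rw [← key x, ← key y]
  exact congrArg (· ^ (2 * m + 1)) hxy

theorem cubicSum_zero_right (hq : Fintype.card F % 3 = 2) {ψ : AddChar F ℂ} (hψ : ψ ≠ 1) {a : F}
    (ha : a ≠ 0) : cubicSum ψ a 0 = 0 := by
  classical
  have h := AddChar.sum_mulShift a (AddChar.IsPrimitive.of_ne_one hψ)
  rw [← (bijective_cube hq).sum_comp (fun x => ψ (x * a))] at h
  simpa [cubicSum, mul_comm a, ha] using h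

theorem sum_cubicSum {ψ : AddChar F ℂ} (hψ : ψ ≠ 1) (a : F) :
    ∑ b, cubicSum ψ a b = Fintype.card F := by
  classical
  simp only [cubicSum]
  rw [sum_comm]
  simp_rw [AddChar.map_add_eq_mul, ← mul_sum,
    AddChar.sum_mulShift _ (AddChar.IsPrimitive.of_ne_one hψ)]
  simp

theorem nonneg_of_forall_re_cubicSum_le (hq : Fintype.card F % 3 = 2) {ψ : AddChar F ℂ}
    (hψ : ψ ≠ 1) {M : ℝ} (hM : ∀ a b, a ≠ 0 → b ≠ 0 → (cubicSum ψ a b).re ≤ M) : 0 ≤ M := by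
  by_contra! hlt
  have h1 : ∑ b : F, (cubicSum ψ 1 b).re = Fintype.card F := by
    rw [← Complex.re_sum, sum_cubicSum hψ, Complex.natCast_re]
  have h2 : ∑ b : F, (cubicSum ψ 1 b).re ≤ 0 := sum_nonpos fun b _ => by
    rcases eq_or_ne b 0 with rfl | hb
    · simp [cubicSum_zero_right hq hψ]
    · exact (hM 1 b one_ne_zero hb).trans hlt.le
  rw [h1] at h2
  exact absurd h2 (not_le.2 (Nat.cast_pos.2 Fintype.card_pos))

end CubicSum

theorem expSum_cubic (p : ℕ) [NeZero p] (F : Type) [Field F] [Fintype F] [Algebra (ZMod p) F]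
    (a b : F) : expSum p F (C a * X ^ 3 + C b * X) = cubicSum (traceChar p F) a b := by
  refine sum_congr rfl fun x _ => ?_
  rw [traceChar_apply, ZMod.stdAddChar_apply, ZMod.toCircle_apply, ← Complex.exp_nat_mul]
  simp only [eval_add, eval_mul, eval_C, eval_pow, eval_X]
  congr 1
  ring

section Cayley

variable {F : Type*} [Field F]

/-- The connection vectors `(t, tx, t³x^p, t³x^(p²), …)` of the graph, for `τ = (t, x)`. -/
def connVec (p n : ℕ) (τ : F × F) : Fin (n + 3) → F :=
  Matrix.vecCons τ.1 (Matrix.vecCons (τ.1 * τ.2) fun j : Fin (n + 1) =>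
    τ.1 ^ 3 * τ.2 ^ p ^ ((j : ℕ) + 1))

/-- The coefficient of `t³` in `w ⬝ᵥ connVec p n (t, x)`. -/
def cubicCoeff (p : ℕ) {n : ℕ} (w : Fin (n + 3) → F) (x : F) : F :=
  ∑ j : Fin (n + 1), w j.succ.succ * x ^ p ^ ((j : ℕ) + 1)

theorem dotProduct_connVec (p n : ℕ) (w : Fin (n + 3) → F) (t x : F) :
    w ⬝ᵥ connVec p n (t, x) = cubicCoeff p w x * t ^ 3 + (w 0 + w 1 * x) * t := by
  rw [dotProduct, Fin.sum_univ_succ, Fin.sum_univ_succ, cubicCoeff, sum_mul]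
  simp only [connVec, Matrix.cons_val_zero, Matrix.cons_val_succ, Fin.succ_zero_eq_one,
    Matrix.cons_val_one, mul_left_comm (w _) (t ^ 3), mul_comm _ (t ^ 3)]
  ring

theorem cubicCoeff_zero {p : ℕ} (hp : p ≠ 0) {n : ℕ} (w : Fin (n + 3) → F) :
    cubicCoeff p w 0 = 0 :=
  sum_eq_zero fun j _ => by rw [zero_pow (pow_ne_zero _ hp), mul_zero]

variable [Fintype F]

/-- The index set of the connection vectors. -/
def connIndex (F : Type*) [Field F] [Fintype F] [DecidableEq F] : Finset (F × F) :=
  univ.erase 0 ×ˢ univ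

theorem sum_addChar_dotProduct_connVec [DecidableEq F] (p n : ℕ) (ψ : AddChar F ℂ)
    (w : Fin (n + 3) → F) :
    ∑ τ ∈ connIndex F, ψ (w ⬝ᵥ connVec p n τ) =
      ((∑ x, ((cubicSum ψ (cubicCoeff p w x) (w 0 + w 1 * x)).re - 1) : ℝ) : ℂ) := by
  rw [connIndex, sum_product_right]
  push_cast
  refine sum_congr rfl fun x _ => ?_
  rw [sum_erase_eq_sub (mem_univ _), ofReal_re_cubicSum, cubicSum]
  simp [dotProduct_connVec]

theorem card_cubicCoeff_eq_zero_le {p : ℕ} [hp : Fact p.Prime] [CharP F p] {n : ℕ}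
    {w : Fin (n + 3) → F} {j : Fin (n + 1)} (hw : w j.succ.succ ≠ 0) [DecidableEq F] :
    #{x | cubicCoeff p w x = 0} ≤ p ^ n := by
  set f : F[X] := ∑ j : Fin (n + 1), C (w j.succ.succ) * X ^ p ^ (j : ℕ) with hf
  have hcoeff : f.coeff (p ^ (j : ℕ)) = w j.succ.succ := by
    rw [hf, finsetSum_coeff, sum_eq_single j]
    · simp
    · intro i _ hij
      rw [coeff_C_mul_X_pow, if_neg]
      intro h
      exact hij (Fin.ext (Nat.pow_right_injective hp.out.two_le h).symm)
    · simp
  have hf0 : f ≠ 0 := by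
    intro h
    rw [h, coeff_zero] at hcoeff
    exact hw hcoeff.symm
  have hdeg : f.natDegree ≤ p ^ n := natDegree_sum_le_of_forall_le _ _ fun i _ =>
    (natDegree_C_mul_X_pow_le _ _).trans
      (Nat.pow_le_pow_right hp.out.pos (Nat.lt_succ_iff.1 i.2))
  refine le_trans ?_ ((card_le_degree_of_subset_roots (p := f) (Z := f.roots.toFinset)
    (fun x hx => by simpa using hx)).trans hdeg)
  refine card_le_card_of_injOn (fun x => x ^ p) ?_ (frobenius_inj F p).injOn
  intro x hx
  have hx' : cubicCoeff p w x = 0 := by simpa using hx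
  rw [mem_coe, Multiset.mem_toFinset, mem_roots hf0, IsRoot.def, hf, eval_finsetSum, ← hx',
    cubicCoeff]
  refine sum_congr rfl fun i _ => ?_
  simp [← pow_mul, pow_succ']

/-- The bound for the eigenvalues of the graph belonging to nontrivial characters. -/
theorem eigenvalue_le {p : ℕ} [hp : Fact p.Prime] [CharP F p] {n : ℕ}
    (hq : Fintype.card F % 3 = 2) {ψ : AddChar F ℂ} (hψ : ψ ≠ 1) {M : ℝ}
    (hM : ∀ a b, a ≠ 0 → b ≠ 0 → (cubicSum ψ a b).re ≤ M) {w : Fin (n + 3) → F} (hw : w ≠ 0) :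
    ∑ x, ((cubicSum ψ (cubicCoeff p w x) (w 0 + w 1 * x)).re - 1) ≤
      max ((Fintype.card F : ℝ) * ((p : ℝ) ^ n - 1)) (((Fintype.card F : ℝ) - 1) * M) := by
  classical
  have hM0 : 0 ≤ M := nonneg_of_forall_re_cubicSum_le hq hψ hM
  have hc0 : cubicCoeff p w 0 = 0 := cubicCoeff_zero hp.out.ne_zero w
  have hgen : ∀ a b : F, b ≠ 0 → (cubicSum ψ a b).re ≤ M := fun a b hb => by
    rcases eq_or_ne a 0 with rfl | ha
    · simpa [cubicSum_zero_left hψ, hb] using hM0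
    · exact hM a b ha hb
  have hzero : ∀ a : F, (cubicSum ψ a 0).re = if a = 0 then (Fintype.card F : ℝ) else 0 :=
    fun a => by
      split_ifs with ha
      · simp [ha, cubicSum_zero_left hψ]
      · simp [cubicSum_zero_right hq hψ ha]
  have hzero_le : ∀ a : F, (cubicSum ψ a 0).re ≤ Fintype.card F := fun a => by
    rw [hzero]
    split_ifs <;> simp
  have hleft : ∀ b : F, b ≠ 0 → (cubicSum ψ 0 b).re = 0 := fun b hb => by
    simp [cubicSum_zero_left hψ, hb]
  by_cases h1 : w 1 = 0
  · by_cases h0 : w 0 = 0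
    · refine le_max_of_le_left ?_
      obtain ⟨j, hj⟩ : ∃ j : Fin (n + 1), w j.succ.succ ≠ 0 := by
        by_contra! hall
        refine hw (funext fun i => ?_)
        refine Fin.cases h0 (fun i => ?_) i
        exact Fin.cases h1 hall i
      have hcard : (#{x | cubicCoeff p w x = 0} : ℝ) ≤ (p : ℝ) ^ n := by
        exact_mod_cast card_cubicCoeff_eq_zero_le hj
      simp only [h0, h1, zero_mul, add_zero, hzero, sum_sub_distrib, sum_ite, sum_const_zero,
        sum_const, nsmul_eq_mul, card_univ, mul_one]
      nlinarith [(Nat.cast_nonneg (Fintype.card F) : (0 : ℝ) ≤ _)]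
    · refine le_max_of_le_right ?_
      calc _ ≤ ∑ x : F, ((M - 1) - if x = 0 then M else 0) := by
            refine sum_le_sum fun x _ => ?_
            simp only [h1, zero_mul, add_zero]
            split_ifs with hx
            · rw [hx, hc0, hleft _ h0]; linarith
            · linarith [hgen (cubicCoeff p w x) _ h0]
        _ ≤ _ := by
            simp only [sum_sub_distrib, sum_ite_eq', mem_univ, if_true, sum_const, nsmul_eq_mul,
              card_univ]
            nlinarith [(Nat.cast_nonneg (Fintype.card F) : (0 : ℝ) ≤ _)]
  · refine le_max_of_le_right ?_
    set x₀ := -w 0 / w 1 with hx₀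
    have hd : ∀ x, w 0 + w 1 * x = 0 ↔ x = x₀ := fun x => by
      rw [hx₀, eq_div_iff h1, eq_neg_iff_add_eq_zero, add_comm, mul_comm]
    calc _ ≤ ∑ x : F, ((M - 1) + (if x = x₀ then (Fintype.card F - M : ℝ) else 0) -
            if x = 0 then (if x₀ = 0 then 0 else M) else 0) := by
          refine sum_le_sum fun x _ => ?_
          by_cases hx : x = x₀
          · rw [(hd x).2 hx, if_pos hx]
            by_cases hx0 : x₀ = 0
            · simp only [hx0, if_true, ite_self]
              linarith [hzero_le (cubicCoeff p w x)]
            · rw [if_neg (hx ▸ hx0)]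
              linarith [hzero_le (cubicCoeff p w x)]
          · have hdx := (hd x).not.2 hx
            rw [if_neg hx]
            by_cases hx0 : x = 0
            · rw [if_pos hx0, if_neg fun h => hx (hx0.trans h.symm)]
              rw [hx0, hc0, hleft _ (hx0 ▸ hdx)]
              linarith
            · rw [if_neg hx0]
              linarith [hgen (cubicCoeff p w x) _ hdx]
      _ ≤ _ := by
          simp only [sum_sub_distrib, sum_add_distrib, sum_ite_eq', mem_univ, if_true, sum_const,
            nsmul_eq_mul, card_univ]
          split_ifs <;> nlinarith

end Cayley

theorem secondLargestEig_le {V : Type} [Fintype V] [DecidableEq V] {A : Matrix V V ℝ}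
    (hA : A.IsHermitian) (hV : 2 ≤ Fintype.card V) {B : ℝ}
    (h : ∀ i j, B < hA.eigenvalues i → B < hA.eigenvalues j → i = j) :
    secondLargestEig hA ≤ B := by
  by_contra! hlt
  set l := eigSorted hA with hl
  have hlen : l.length = Fintype.card V := by simp [hl, eigSorted]
  have hsort : l.Pairwise (· ≤ ·) := Multiset.pairwise_sort _ _
  have hidx : Fintype.card V - 2 < l.length := by omega
  rw [secondLargestEig, ← hl, List.getD_eq_getElem _ _ hidx] at hlt
  have hcount : l.countP (B < ·) ≤ 1 := by
    rw [← Multiset.coe_countP, hl, eigSorted, Multiset.sort_eq, Multiset.countP_map]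
    change #{i | B < hA.eigenvalues i} ≤ 1
    refine card_le_one.2 fun i hi j hj => ?_
    exact h i j (by simpa using hi) (by simpa using hj)
  have hdrop : (l.drop (Fintype.card V - 2)).countP (B < ·) = 2 := by
    rw [List.countP_eq_length.2]
    · rw [List.length_drop]; omega
    · intro x hx
      obtain ⟨i, hi, rfl⟩ := List.mem_iff_getElem.1 hx
      rw [List.getElem_drop]
      simp only [decide_eq_true_eq]
      exact hlt.trans_le (hsort.sortedLE.getElem_le_getElem_of_le (by omega))
  have := (List.drop_sublist (Fintype.card V - 2) l).countP_le (p := (B < ·))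
  omega

section Graph

variable {F : Type} [Field F] [Fintype F] [DecidableEq F] {p n : ℕ}

theorem connVec_injOn : Set.InjOn (connVec (F := F) p n) (connIndex F) := by
  rintro ⟨t, x⟩ hτ ⟨t', x'⟩ - h
  have ht : t = t' := congrFun h 0
  have hx : t * x = t' * x' := congrFun h 1
  have h0 : t ≠ 0 := by simpa [connIndex] using hτ
  rw [← ht] at hx
  rw [← ht, mul_left_cancel₀ h0 hx]

theorem card_connIndex : #(connIndex F) = (Fintype.card F - 1) * Fintype.card F := by
  rw [connIndex, card_product, card_erase_of_mem (mem_univ _), card_univ]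

variable {G : SimpleGraph (Fin (n + 3) → F)} [DecidableRel G.Adj]

theorem sum_neighborFinset {M : Type*} [AddCommMonoid M]
    (hG : ∀ a b, G.Adj a b ↔ ∃ τ ∈ connIndex F, a + connVec p n τ = b)
    (v : (Fin (n + 3) → F) → M) (a : Fin (n + 3) → F) :
    ∑ b ∈ G.neighborFinset a, v b = ∑ τ ∈ connIndex F, v (a + connVec p n τ) := by
  have h : G.neighborFinset a = (connIndex F).image fun τ => a + connVec p n τ := by
    ext b
    rw [SimpleGraph.mem_neighborFinset, hG, mem_image]
  rw [h, sum_image]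
  exact fun τ hτ τ' hτ' h => connVec_injOn hτ hτ' (add_left_cancel h)

theorem connected_of_sum_addChar_ne
    (hG : ∀ a b, G.Adj a b ↔ ∃ τ ∈ connIndex F, a + connVec p n τ = b)
    {ψ : AddChar F ℂ} (hψ : ψ ≠ 1)
    (h : ∀ w, w ≠ 0 → ∑ τ ∈ connIndex F, ψ (w ⬝ᵥ connVec p n τ) ≠ #(connIndex F)) :
    G.Connected := by
  classical
  refine (SimpleGraph.connected_iff _).2 ⟨fun a b => ?_, inferInstance⟩
  have hconst := eigenfunction_const hψ (connIndex F) (connVec p n)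
    (fun b => if G.Reachable a b then (1 : ℂ) else 0) (fun x => ?_) h a b
  · by_contra hab
    simp [hab] at hconst
  · rw [sum_congr rfl fun τ hτ => ?_, sum_const, nsmul_eq_mul]
    have hx : G.Adj x (x + connVec p n τ) := (hG _ _).2 ⟨τ, hτ, rfl⟩
    exact if_congr ⟨fun h => h.trans hx.symm.reachable, fun h => h.trans hx.reachable⟩ rfl rfl

theorem secondLargestEig_le_of_sum_addChar
    (hG : ∀ a b, G.Adj a b ↔ ∃ τ ∈ connIndex F, a + connVec p n τ = b)
    (hA : (G.adjMatrix ℝ).IsHermitian) {ψ : AddChar F ℂ} (hψ : ψ ≠ 1) {B : ℝ}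
    (h : ∀ w, w ≠ 0 → (∑ τ ∈ connIndex F, ψ (w ⬝ᵥ connVec p n τ)).re ≤ B) :
    secondLargestEig hA ≤ B := by
  refine secondLargestEig_le hA ?_ fun i j hi hj => ?_
  · exact Fintype.one_lt_card
  have hconst : ∀ i, B < hA.eigenvalues i → ∀ x y, hA.eigenvectorBasis i x =
      hA.eigenvectorBasis i y := by
    intro i hi x y
    have := eigenfunction_const hψ (connIndex F) (connVec p n) (μ := hA.eigenvalues i)
      (fun b => (hA.eigenvectorBasis i b : ℂ)) (fun x => ?_) (fun w hw hμ => ?_) x y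
    · exact_mod_cast this
    · rw [← sum_neighborFinset hG fun b => (hA.eigenvectorBasis i b : ℂ)]
      have := congrFun (hA.mulVec_eigenvectorBasis i) x
      rw [SimpleGraph.adjMatrix_mulVec_apply] at this
      simp only [Pi.smul_apply, smul_eq_mul] at this
      exact_mod_cast this
    · have := h w hw
      rw [hμ, Complex.ofReal_re] at this
      exact this.not_gt hi
  by_contra hij
  have horth : inner ℝ (hA.eigenvectorBasis i) (hA.eigenvectorBasis j) = 0 :=
    hA.eigenvectorBasis.orthonormal.2 hij
  have hnz : ∀ i, B < hA.eigenvalues i → hA.eigenvectorBasis i 0 ≠ 0 := by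
    intro i hi h0
    refine hA.eigenvectorBasis.orthonormal.ne_zero i ?_
    ext x
    exact (hconst i hi x 0).trans h0
  rw [PiLp.inner_apply] at horth
  simp only [hconst i hi _ 0, hconst j hj _ 0, sum_const, card_univ, nsmul_eq_mul] at horth
  refine mul_ne_zero (Nat.cast_ne_zero.2 Fintype.card_ne_zero) ?_ horth
  exact mul_ne_zero (hnz j hj) (hnz i hi)

end Graph

/-- for odd `q = p^e ≡ 2 (mod 3)`, `3 ≤ k ≤ e+2`, `g_i(X) = X³`,
`f_i(X) = X^{p^{i−2}}`, the graph `S(k,q)` is connected and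
`λ₂(S(k,q)) ≤ max{q(p^{k−3}−1), (q−1)M_q}`, with `M_q ≤ 2√q`. -/
theorem stmt_12 (p e q k : ℕ) (hp : p.Prime) (he : 1 ≤ e) (hq : q = p ^ e)
    (hqodd : Odd q) (hq3 : q % 3 = 2) (hk : 3 ≤ k) (hke : k ≤ e + 2)
    (F : Type) [Field F] [Fintype F] [DecidableEq F] [Algebra (ZMod p) F]
    (hcard : Fintype.card F = q)
    (f g : Fin k → Polynomial F)
    (hf : ∀ i : Fin k, 2 ≤ (i : ℕ) → f i = Polynomial.X ^ (p ^ ((i : ℕ) - 1)))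
    (hg : ∀ i : Fin k, 2 ≤ (i : ℕ) → g i = Polynomial.X ^ 3)
    (G : SimpleGraph (Fin k → F)) [DecidableRel G.Adj]
    (hAdj : ∀ a b : Fin k → F, G.Adj a b ↔
      (a ⟨0, by omega⟩ ≠ b ⟨0, by omega⟩ ∧ ∀ i : Fin k, 2 ≤ (i : ℕ) →
        b i - a i = (g i).eval (b ⟨0, by omega⟩ - a ⟨0, by omega⟩) *
          (f i).eval ((b ⟨1, by omega⟩ - a ⟨1, by omega⟩) / (b ⟨0, by omega⟩ - a ⟨0, by omega⟩))))
    (hA : (G.adjMatrix ℝ).IsHermitian)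
    (Mq : ℝ)
    (hMq : IsGreatest {r : ℝ | ∃ a b : F, a ≠ 0 ∧ b ≠ 0 ∧
      expSum p F (Polynomial.C a * Polynomial.X ^ 3 + Polynomial.C b * Polynomial.X) = (r : ℂ)}
      Mq) :
    G.Connected ∧
      secondLargestEig hA ≤
        max ((q : ℝ) * ((p : ℝ) ^ (k - 3) - 1)) (((q : ℝ) - 1) * Mq) ∧
      Mq ≤ 2 * Real.sqrt q := by
  obtain ⟨n, rfl⟩ : ∃ n, k = n + 3 := ⟨k - 3, by omega⟩
  have : Fact p.Prime := ⟨hp⟩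
  have : CharP F p := charP_of_injective_algebraMap (algebraMap (ZMod p) F).injective p
  have hp2 : p ≠ 2 := by
    rintro rfl
    rw [hq, Nat.odd_pow_iff (by omega)] at hqodd
    exact absurd hqodd (by decide)
  have hp3 : p ≠ 3 := by
    rintro rfl
    have := dvd_pow_self 3 (show e ≠ 0 by omega)
    omega
  have hq5 : 5 ≤ q := by
    have := hp.two_le
    have := Nat.le_self_pow (show e ≠ 0 by omega) p
    obtain ⟨m, hm⟩ := hqodd
    omega
  set ψ := traceChar p F
  have hψ : ψ ≠ 1 := traceChar_ne_one p F
  have hcard3 : Fintype.card F % 3 = 2 := by rw [hcard, hq3]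
  have hM : ∀ a b, a ≠ 0 → b ≠ 0 → (cubicSum ψ a b).re ≤ Mq := fun a b ha hb =>
    hMq.2 ⟨a, b, ha, hb, by rw [expSum_cubic, ofReal_re_cubicSum]⟩
  have hMq_le : Mq ≤ 2 * √q := by
    obtain ⟨a, b, ha, -, hab⟩ := hMq.1
    rw [expSum_cubic] at hab
    have := norm_cubicSum_le hp2 hp3 hψ ha b
    rw [hab, Complex.norm_real, hcard] at this
    exact (le_abs_self _).trans this
  have hG : ∀ a b, G.Adj a b ↔ ∃ τ ∈ connIndex F, a + connVec p n τ = b := by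
    intro a b
    rw [hAdj]
    have h0 : (⟨0, by omega⟩ : Fin (n + 3)) = 0 := rfl
    have h1 : (⟨1, by omega⟩ : Fin (n + 3)) = 1 := rfl
    simp only [h0, h1]
    have hi : ∀ j : Fin (n + 1), 2 ≤ ((j.succ.succ : Fin (n + 3)) : ℕ) := fun j => by simp
    constructor
    · rintro ⟨hne, h⟩
      have hne' : b 0 - a 0 ≠ 0 := sub_ne_zero.2 hne.symm
      refine ⟨(b 0 - a 0, (b 1 - a 1) / (b 0 - a 0)), by simpa [connIndex] using hne', ?_⟩
      rw [← eq_sub_iff_add_eq']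
      funext i
      refine Fin.cases rfl (fun i => Fin.cases ?_ (fun j => ?_) i) i
      · exact mul_div_cancel₀ _ hne'
      · have := h _ (hi j)
        rw [hf _ (hi j), hg _ (hi j)] at this
        simpa [connVec] using this.symm
    · rintro ⟨⟨t, x⟩, hτ, rfl⟩
      have ht : t ≠ 0 := by simpa [connIndex] using hτ
      refine ⟨by simpa [connVec] using ht, fun i h2 => ?_⟩
      obtain ⟨j, rfl⟩ : ∃ j : Fin (n + 1), j.succ.succ = i :=
        ⟨⟨i - 2, by omega⟩, Fin.ext (by simp; omega)⟩
      rw [hf _ h2, hg _ h2]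
      simp [connVec, ht]
  have hbound : ∀ w : Fin (n + 3) → F, w ≠ 0 →
      (∑ τ ∈ connIndex F, ψ (w ⬝ᵥ connVec p n τ)).re ≤
        max ((q : ℝ) * ((p : ℝ) ^ n - 1)) (((q : ℝ) - 1) * Mq) := by
    intro w hw
    rw [sum_addChar_dotProduct_connVec, Complex.ofReal_re, ← hcard]
    exact eigenvalue_le hcard3 hψ hM hw
  have hq5' : (5 : ℝ) ≤ q := by exact_mod_cast hq5
  have hlt : max ((q : ℝ) * ((p : ℝ) ^ n - 1)) (((q : ℝ) - 1) * Mq) < #(connIndex F) := by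
    rw [card_connIndex, hcard]
    push_cast [show 1 ≤ q by omega]
    refine max_lt ?_ ?_
    · have : (p : ℝ) ^ n < q := by
        rw [hq]
        exact_mod_cast Nat.pow_lt_pow_right hp.one_lt (show n < e by omega)
      nlinarith
    · have hs : 2 * √(q : ℝ) < q := by
        nlinarith [Real.sq_sqrt (Nat.cast_nonneg (α := ℝ) q), Real.sqrt_nonneg (q : ℝ)]
      nlinarith
  refine ⟨connected_of_sum_addChar_ne hG hψ fun w hw h => ?_,
    secondLargestEig_le_of_sum_addChar hG hA hψ hbound, hMq_le⟩
  have := hbound w hw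
  rw [h, Complex.natCast_re] at this
  exact this.not_gt hlt
end

section
/- Let k ≥ 3 and let f_i, g_i ∈ F_q[X] for 3 ≤ i ≤ k+1 be polynomials of degree at most q−1 with g_i(−X) = −g_i(X). Let S(k+1,q) = S(k+1,q; f_3,g_3,…,f_{k+1},g_{k+1}) and S(k,q) = S(k,q; f_3,g_3,…,f_k,g_k). Then the spectrum (multiset of adjacency eigenvalues with multiplicity) of S(k,q) is a sub-multiset of the spectrum of S(k+1,q); in particular, λ_2(S(k+1,q)) ≥ λ_2(S(k,q)). -/
namespace Matrix

variable {R m n r : Type*} [CommRing R] [Fintype m] [DecidableEq m] [Fintype n] [DecidableEq n]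
  [Fintype r] [DecidableEq r]

/-- If the column space of `[1; E]` is invariant under a block matrix, which acts on it as `A`,
then the characteristic polynomial of `A` divides that of the block matrix. -/
theorem charpoly_dvd_charpoly_fromBlocks {A B₁₁ : Matrix n n R} {B₁₂ : Matrix n r R}
    {B₂₁ : Matrix r n R} {B₂₂ : Matrix r r R} {E : Matrix r n R}
    (h₁ : B₁₁ + B₁₂ * E = A) (h₂ : B₂₁ + B₂₂ * E = E * A) :
    A.charpoly ∣ (fromBlocks B₁₁ B₁₂ B₂₁ B₂₂).charpoly := by
  have hinv : (fromBlocks 1 0 (-E) 1 : Matrix (n ⊕ r) (n ⊕ r) R) * fromBlocks 1 0 E 1 = 1 := by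
    simp [fromBlocks_multiply]
  have hconj : fromBlocks B₁₁ B₁₂ B₂₁ B₂₂ * fromBlocks 1 0 E 1 =
      fromBlocks 1 0 E 1 * fromBlocks A B₁₂ 0 (B₂₂ - E * B₁₂) := by
    simp [fromBlocks_multiply, h₁, h₂]
  have hchar : (fromBlocks B₁₁ B₁₂ B₂₁ B₂₂).charpoly =
      (fromBlocks A B₁₂ 0 (B₂₂ - E * B₁₂)).charpoly := by
    rw [← mul_one (fromBlocks B₁₁ B₁₂ B₂₁ B₂₂), ← mul_eq_one_comm.mp hinv, ← mul_assoc, hconj,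
      charpoly_mul_comm, ← mul_assoc, hinv, one_mul]
  rw [hchar, charpoly_fromBlocks_zero₂₁]
  exact dvd_mul_right _ _

/-- The characteristic polynomial of the quotient of a matrix by an equitable partition divides
the characteristic polynomial of the matrix. The parts are the fibres of `π`. -/
theorem charpoly_dvd_charpoly_of_sum_fiber {A : Matrix n n R} {B : Matrix m m R} {π : m → n}
    (hπ : π.Surjective) (h : ∀ x w, ∑ y with π y = w, B x y = A (π x) w) :
    A.charpoly ∣ B.charpoly := by
  classical
  obtain ⟨σ, hσ⟩ := hπ.hasRightInverse
  let e : n ⊕ ((Set.range σ)ᶜ : Set m) ≃ m :=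
    (Equiv.sumCongr (Equiv.ofInjective σ hσ.injective) (Equiv.refl _)).trans
      (Equiv.Set.sumCompl (Set.range σ))
  let E : Matrix ((Set.range σ)ᶜ : Set m) n R :=
    of fun x w => if π x = w then 1 else 0
  have key (x : m) (w : n) : B x (σ w) + ∑ y : ((Set.range σ)ᶜ : Set m), B x y * E y w =
      A (π x) w := by
    rw [← h, Finset.sum_filter, ← e.sum_comp, Fintype.sum_sum_type]
    simp [e, E, hσ _]
  rw [← charpoly_reindex e.symm B, ← fromBlocks_toBlocks (reindex e.symm e.symm B)]
  refine charpoly_dvd_charpoly_fromBlocks (E := E) ?_ ?_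
  · ext v w
    simpa [mul_apply, toBlocks₁₁, toBlocks₁₂, e, hσ v] using key (σ v) w
  · ext x w
    simpa [mul_apply, toBlocks₂₁, toBlocks₂₂, e, E] using key x w

end Matrix

theorem List.Sublist.getD_length_sub_two_le {α : Type*} [Preorder α] {l₁ l₂ : List α} (d : α)
    (h : l₁.Sublist l₂) (hl : 2 ≤ l₁.length) (hs : l₂.SortedLE) :
    l₁.getD (l₁.length - 2) d ≤ l₂.getD (l₂.length - 2) d := by
  have hlen := h.length_le
  obtain ⟨φ, hφ⟩ := List.sublist_iff_exists_fin_orderEmbedding_get_eq.mp h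
  have hlt : φ ⟨l₁.length - 2, by omega⟩ < φ ⟨l₁.length - 1, by omega⟩ :=
    φ.strictMono (Fin.mk_lt_mk.mpr (by omega))
  rw [List.getD_eq_getElem _ _ (by omega), List.getD_eq_getElem _ _ (by omega)]
  have hget := hφ ⟨l₁.length - 2, by omega⟩
  simp only [List.get_eq_getElem] at hget
  rw [hget]
  exact hs.getElem_le_getElem_of_le (by have := Fin.lt_def.mp hlt; omega)

theorem length_eigSorted {V : Type} [Fintype V] [DecidableEq V] {A : Matrix V V ℝ}
    (hA : A.IsHermitian) : (eigSorted hA).length = Fintype.card V := by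
  simp [eigSorted]

theorem eigSorted_sublist_of_charpoly_dvd {V W : Type} [Fintype V] [DecidableEq V] [Fintype W]
    [DecidableEq W] {A : Matrix V V ℝ} {B : Matrix W W ℝ} (hA : A.IsHermitian)
    (hB : B.IsHermitian) (h : A.charpoly ∣ B.charpoly) :
    (eigSorted hA).Sublist (eigSorted hB) := by
  have hle := Polynomial.roots.le_of_dvd B.charpoly_monic.ne_zero h
  rw [hA.roots_charpoly_eq_eigenvalues, hB.roots_charpoly_eq_eigenvalues] at hle
  refine List.sublist_of_subperm_of_pairwise (r := (· ≤ ·)) ?_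
    (Multiset.pairwise_sort _ _) (Multiset.pairwise_sort _ _)
  rw [← Multiset.coe_le, eigSorted, eigSorted, Multiset.sort_eq, Multiset.sort_eq]
  exact hle

theorem secondLargestEig_le_of_charpoly_dvd {V W : Type} [Fintype V] [DecidableEq V] [Fintype W]
    [DecidableEq W] {A : Matrix V V ℝ} {B : Matrix W W ℝ} (hA : A.IsHermitian)
    (hB : B.IsHermitian) (hV : 2 ≤ Fintype.card V) (h : A.charpoly ∣ B.charpoly) :
    secondLargestEig hA ≤ secondLargestEig hB := by
  have hsub := (eigSorted_sublist_of_charpoly_dvd hA hB h).getD_length_sub_two_le 0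
    (by rwa [length_eigSorted]) (Multiset.pairwise_sort _ _).sortedLE
  rwa [length_eigSorted, length_eigSorted] at hsub

/-- If the surjection `π` is a graph homomorphism along which every neighbour of `π x` lifts to
exactly one neighbour of `x`, then the characteristic polynomial of the base graph divides that of
the covering graph. -/
theorem SimpleGraph.charpoly_adjMatrix_dvd_of_covering {R V W : Type*} [CommRing R] [Fintype V]
    [DecidableEq V] [Fintype W] [DecidableEq W] {G : SimpleGraph V} [DecidableRel G.Adj]
    {H : SimpleGraph W} [DecidableRel H.Adj] {π : W → V} (hπ : π.Surjective)
    (hmap : ∀ x y, H.Adj x y → G.Adj (π x) (π y))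
    (hlift : ∀ x w, G.Adj (π x) w → ∃! y, π y = w ∧ H.Adj x y) :
    (G.adjMatrix R).charpoly ∣ (H.adjMatrix R).charpoly := by
  refine Matrix.charpoly_dvd_charpoly_of_sum_fiber hπ fun x w => ?_
  simp only [SimpleGraph.adjMatrix_apply]
  split_ifs with hw
  · obtain ⟨y, ⟨hy, hxy⟩, huniq⟩ := hlift x w hw
    rw [Finset.sum_eq_single_of_mem y (by simp [hy]), if_pos hxy]
    intro z hz hne
    exact if_neg fun hxz => hne (huniq z ⟨(Finset.mem_filter.mp hz).2, hxz⟩)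
  · refine Finset.sum_eq_zero fun y hy => if_neg fun hxy => hw ?_
    rw [← (Finset.mem_filter.mp hy).2]
    exact hmap x y hxy

/-- the spectrum of `S(k,q)` is a sub-multiset of the spectrum of `S(k+1,q)`
(spectra taken as multisets of roots of the characteristic polynomials of the adjacency
matrices over `ℂ`); in particular `λ₂(S(k+1,q)) ≥ λ₂(S(k,q))`. -/
theorem stmt_16 (p e q k : ℕ) (hp : p.Prime) (he : 1 ≤ e) (hq : q = p ^ e) (hk : 3 ≤ k)
    (F : Type) [Field F] [Fintype F] [DecidableEq F] (hcard : Fintype.card F = q)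
    (f g : Fin (k + 1) → Polynomial F)
    (hdegf : ∀ i : Fin (k + 1), 2 ≤ (i : ℕ) → (f i).natDegree ≤ q - 1)
    (hdegg : ∀ i : Fin (k + 1), 2 ≤ (i : ℕ) → (g i).natDegree ≤ q - 1)
    (hodd : ∀ i : Fin (k + 1), 2 ≤ (i : ℕ) → (g i).comp (-Polynomial.X) = -(g i))
    (G : SimpleGraph (Fin k → F)) [DecidableRel G.Adj]
    (hAdj : ∀ a b : Fin k → F, G.Adj a b ↔
      (a ⟨0, by omega⟩ ≠ b ⟨0, by omega⟩ ∧ ∀ i : Fin k, 2 ≤ (i : ℕ) →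
        b i - a i = (g i.castSucc).eval (b ⟨0, by omega⟩ - a ⟨0, by omega⟩) *
          (f i.castSucc).eval
            ((b ⟨1, by omega⟩ - a ⟨1, by omega⟩) / (b ⟨0, by omega⟩ - a ⟨0, by omega⟩))))
    (G' : SimpleGraph (Fin (k + 1) → F)) [DecidableRel G'.Adj]
    (hAdj' : ∀ a b : Fin (k + 1) → F, G'.Adj a b ↔
      (a ⟨0, by omega⟩ ≠ b ⟨0, by omega⟩ ∧ ∀ i : Fin (k + 1), 2 ≤ (i : ℕ) →
        b i - a i = (g i).eval (b ⟨0, by omega⟩ - a ⟨0, by omega⟩) *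
          (f i).eval ((b ⟨1, by omega⟩ - a ⟨1, by omega⟩) / (b ⟨0, by omega⟩ - a ⟨0, by omega⟩))))
    (hA : (G.adjMatrix ℝ).IsHermitian) (hA' : (G'.adjMatrix ℝ).IsHermitian) :
    (G.adjMatrix ℂ).charpoly.roots ≤ (G'.adjMatrix ℂ).charpoly.roots ∧
      secondLargestEig hA ≤ secondLargestEig hA' := by
  have hsurj : Function.Surjective (Fin.init : (Fin (k + 1) → F) → Fin k → F) :=
    fun v => ⟨Fin.snoc v 0, Fin.init_snoc _ _⟩
  have hmap (x y : Fin (k + 1) → F) (hxy : G'.Adj x y) : G.Adj (Fin.init x) (Fin.init y) := by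
    rw [hAdj'] at hxy
    rw [hAdj]
    exact ⟨hxy.1, fun i hi => hxy.2 i.castSucc hi⟩
  have hlift (x : Fin (k + 1) → F) (w : Fin k → F) (hw : G.Adj (Fin.init x) w) :
      ∃! y : Fin (k + 1) → F, Fin.init y = w ∧ G'.Adj x y := by
    have hw' := (hAdj _ _).mp hw
    let c : F := (g (Fin.last k)).eval (w ⟨0, by omega⟩ - x ⟨0, by omega⟩) *
      (f (Fin.last k)).eval
        ((w ⟨1, by omega⟩ - x ⟨1, by omega⟩) / (w ⟨0, by omega⟩ - x ⟨0, by omega⟩))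
    have hsnoc (s : F) (i : Fin k) :
        (Fin.snoc w s : Fin (k + 1) → F) i.castSucc = w i := Fin.snoc_castSucc _ _ _
    refine ⟨Fin.snoc w (x (Fin.last k) + c), ⟨Fin.init_snoc _ _, ?_⟩, ?_⟩
    · have h0 := hsnoc (x (Fin.last k) + c) ⟨0, by omega⟩
      have h1 := hsnoc (x (Fin.last k) + c) ⟨1, by omega⟩
      simp only [Fin.castSucc_mk] at h0 h1
      rw [hAdj', h0, h1]
      refine ⟨hw'.1, fun i => ?_⟩
      refine Fin.lastCases (fun _ => ?_) (fun j hj => ?_) i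
      · rw [Fin.snoc_last, add_sub_cancel_left]
      · rw [hsnoc]
        exact hw'.2 j hj
    · rintro y ⟨rfl, hy⟩
      have hlast := ((hAdj' _ _).mp hy).2 (Fin.last k) (by simp; omega)
      rw [sub_eq_iff_eq_add'] at hlast
      conv_lhs => rw [← Fin.snoc_init_self y, hlast]
      rfl
  have hV : 2 ≤ Fintype.card (Fin k → F) := by
    have : Nonempty (Fin k) := ⟨⟨0, by omega⟩⟩
    exact Fintype.one_lt_card
  exact ⟨Polynomial.roots.le_of_dvd (Matrix.charpoly_monic _).ne_zero
      (SimpleGraph.charpoly_adjMatrix_dvd_of_covering hsurj hmap hlift),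
    secondLargestEig_le_of_charpoly_dvd hA hA' hV
      (SimpleGraph.charpoly_adjMatrix_dvd_of_covering hsurj hmap hlift)⟩
end
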